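/- For elementary cellular automaton rule 168 and every n ≥ 0, the density polynomial of the set of n-step preimages of 1 satisfies Σ_{b ∈ 𝐟₁₆₈⁻ⁿ(1)} p^{#₁(b)} q^{#₀(b)} = p^{n+1}(p+2q)^{n}; in particular, substituting p = c₀ and q = 1−c₀, the density of ones after n iterations of rule 168 starting from a Bernoulli distribution with density c₀ is c_n = c₀^{n+1}(2−c₀)^{n}, and for c₀ = 1/2 this gives c_n = 3ⁿ/2^{2n+1}. -/

import Mathlib

/-- Block evolution operator of a radius-1 elementary CA local rule:
it maps a block `b₁…b_m` (`m ≥ 3`) to the block of length `m-2` whose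
`i`-th symbol is `f b_i b_{i+1} b_{i+2}`. -/
def blockMap (f : Bool → Bool → Bool → Bool) : List Bool → List Bool
  | a :: b :: c :: rest => f a b c :: blockMap f (b :: c :: rest)
  | _ => []

/-- Local rule 168: `f₁₆₈(x₁,x₂,x₃) = (x₁ ∨ x₂) ∧ x₃`. -/
def f168 (x₁ x₂ x₃ : Bool) : Bool := (x₁ || x₂) && x₃

theorem blockMap_append_three (f : Bool → Bool → Bool → Bool) (l : List Bool) (x y z : Bool) :
    blockMap f (l ++ [x, y, z]) = blockMap f (l ++ [x, y]) ++ [f x y z] := by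
  induction l with
  | nil => simp [blockMap]
  | cons a l ih =>
    rcases l with _ | ⟨b, _ | ⟨c, l⟩⟩ <;> simp_all [blockMap]

theorem reverse_blockMap (f : Bool → Bool → Bool → Bool) (l : List Bool) :
    (blockMap f l).reverse = blockMap (fun x y z => f z y x) l.reverse := by
  induction l with
  | nil => simp [blockMap]
  | cons a l ih =>
    rcases l with _ | ⟨b, _ | ⟨c, l⟩⟩
    · simp [blockMap]
    · simp [blockMap]
    · have h := blockMap_append_three (fun x y z => f z y x) l.reverse c b a
      simp_all [blockMap]

theorem length_blockMap (f : Bool → Bool → Bool → Bool) (l : List Bool) :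
    (blockMap f l).length = l.length - 2 := by
  induction l with
  | nil => simp [blockMap]
  | cons a l ih =>
    rcases l with _ | ⟨b, _ | ⟨c, l⟩⟩ <;> simp_all [blockMap]

/-- `chain168 n l` holds when `l` starts with a one which is followed by at least `n` further
ones such that consecutive ones are at distance at most two. -/
def chain168 : ℕ → List Bool → Bool
  | 0, true :: _ => true
  | n + 1, true :: true :: l => chain168 n (true :: l)
  | n + 1, true :: false :: l => chain168 n l
  | _, _ => false

theorem chain168_false_cons (n : ℕ) (l : List Bool) : chain168 n (false :: l) = false := by
  cases n <;> simp [chain168]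

theorem chain168_succ (n : ℕ) (l : List Bool) (hl : 2 * n + 3 ≤ l.length) :
    chain168 (n + 1) l = chain168 n (blockMap (fun x y z => f168 z y x) l) := by
  induction n generalizing l with
  | zero =>
    rcases l with _ | ⟨c, _ | ⟨b, _ | ⟨a, l⟩⟩⟩ <;> simp at hl
    cases a <;> cases b <;> cases c <;> simp [blockMap, f168, chain168]
  | succ n ih =>
    rcases l with _ | ⟨c, _ | ⟨b, _ | ⟨a, _ | ⟨d, l⟩⟩⟩⟩ <;> simp at hl
    have h₁ := ih (b :: a :: d :: l) (by simp; omega)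
    have h₂ := ih (a :: d :: l) (by simp; omega)
    cases c
    · simp [blockMap, f168, chain168_false_cons]
    cases b <;> cases a <;> cases d <;>
      simp [blockMap, f168, chain168, chain168_false_cons] at h₁ h₂ ⊢ <;> assumption

theorem iterate_blockMap_f168_eq_iff (n : ℕ) (l : List Bool) (hl : l.length = 2 * n + 1) :
    (blockMap f168)^[n] l = [true] ↔ chain168 n l.reverse = true := by
  induction n generalizing l with
  | zero =>
    obtain ⟨a, rfl⟩ := List.length_eq_one_iff.mp hl
    cases a <;> simp [chain168]
  | succ n ih =>
    rw [Function.iterate_succ_apply, ih _ (by rw [length_blockMap]; omega), reverse_blockMap,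
      chain168_succ n _ (by simp; omega)]

theorem sum_ofFn_succ (g : List Bool → ℝ) (m : ℕ) :
    ∑ v : Fin (m + 1) → Bool, g (List.ofFn v) =
      ∑ v : Fin m → Bool, g (true :: List.ofFn v) +
        ∑ v : Fin m → Bool, g (false :: List.ofFn v) := by
  rw [← (Fin.consEquiv fun _ : Fin (m + 1) => Bool).sum_comp, Fintype.sum_prod_type]
  simp [Fin.consEquiv, List.ofFn_succ]

theorem sum_ofFn_reverse (g : List Bool → ℝ) (m : ℕ) :
    ∑ v : Fin m → Bool, g (List.ofFn v).reverse = ∑ v : Fin m → Bool, g (List.ofFn v) := by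
  rw [← (Equiv.arrowCongr (Fin.revPerm (n := m)) (Equiv.refl Bool)).sum_comp]
  refine Finset.sum_congr rfl fun v _ => ?_
  congr 1
  apply List.ext_getElem
  · simp
  · intro i h₁ h₂
    simp only [List.length_reverse, List.length_ofFn] at h₁
    simp [Fin.rev]
    congr 2
    omega

/-- The weight `p ^ #₁(l) * q ^ #₀(l)` of a block. -/
def blockWeight (p q : ℝ) (l : List Bool) : ℝ := p ^ l.count true * q ^ l.count false

theorem blockWeight_true_cons (p q : ℝ) (l : List Bool) :
    blockWeight p q (true :: l) = p * blockWeight p q l := by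
  simp [blockWeight, pow_succ]; ring

theorem blockWeight_false_cons (p q : ℝ) (l : List Bool) :
    blockWeight p q (false :: l) = q * blockWeight p q l := by
  simp [blockWeight, pow_succ]; ring

theorem sum_blockWeight (p q : ℝ) (m : ℕ) :
    ∑ v : Fin m → Bool, blockWeight p q (List.ofFn v) = (p + q) ^ m := by
  induction m with
  | zero => simp [blockWeight]
  | succ m ih =>
    rw [sum_ofFn_succ]
    simp only [blockWeight_true_cons, blockWeight_false_cons, ← Finset.mul_sum, ih]
    ring

theorem sum_chain168_true_cons (p q : ℝ) (n k : ℕ) :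
    ∑ v : Fin (2 * n + k) → Bool,
        (if chain168 n (true :: List.ofFn v) then blockWeight p q (List.ofFn v) else 0) =
      p ^ n * (p + 2 * q) ^ n * (p + q) ^ k := by
  induction n generalizing k with
  | zero => simpa [chain168] using sum_blockWeight p q (0 + k)
  | succ n ih =>
    have h₁ := ih (k + 1)
    have h₀ := ih k
    rw [show 2 * (n + 1) + k = (2 * n + (k + 1)) + 1 by ring,
      sum_ofFn_succ fun l => if chain168 (n + 1) (true :: l) then blockWeight p q l else 0]
    simp only [chain168, blockWeight_true_cons, blockWeight_false_cons, ← mul_ite_zero,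
      ← Finset.mul_sum, h₁]
    rw [← add_assoc, sum_ofFn_succ fun l => if chain168 n l then blockWeight p q l else 0]
    simp only [chain168_false_cons, blockWeight_true_cons, ← mul_ite_zero, ← Finset.mul_sum, h₀,
      Bool.false_eq_true, if_false, Finset.sum_const_zero]
    ring

theorem sum_preimages_f168 (n : ℕ) (p q : ℝ) :
    ∑ b ∈ Finset.univ.filter
        (fun b : Fin (2*n+1) → Bool => (blockMap f168)^[n] (List.ofFn b) = [true]),
      p ^ (List.ofFn b).count true * q ^ (List.ofFn b).count false
    = p ^ (n+1) * (p + 2*q) ^ n := by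
  have h := sum_chain168_true_cons p q n 0
  rw [add_zero] at h
  calc
    _ = ∑ v : Fin (2 * n + 1) → Bool, if chain168 n (List.ofFn v).reverse then
          blockWeight p q (List.ofFn v).reverse else 0 := by
      rw [Finset.sum_filter]
      refine Finset.sum_congr rfl fun v _ => ?_
      simp only [iterate_blockMap_f168_eq_iff n _ (List.length_ofFn (f := v)), blockWeight,
        List.count_reverse]
    _ = _ := by
      rw [sum_ofFn_reverse fun l => if chain168 n l then blockWeight p q l else 0,
        sum_ofFn_succ fun l => if chain168 n l then blockWeight p q l else 0]
      simp only [chain168_false_cons, blockWeight_true_cons, ← mul_ite_zero, ← Finset.mul_sum, h,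
        Bool.false_eq_true, if_false, Finset.sum_const_zero]
      ring

/-- For rule 168 and every `n ≥ 0`, the density polynomial of the set of `n`-step
preimages of `1` is `Σ_{b ∈ 𝐟₁₆₈⁻ⁿ(1)} p^{#₁(b)} q^{#₀(b)} = p^{n+1}(p+2q)ⁿ`;
substituting `p = c₀`, `q = 1-c₀` gives the density `c_n = c₀^{n+1}(2-c₀)ⁿ`, and
for `c₀ = 1/2` this yields `c_n = 3ⁿ/2^{2n+1}`. -/
theorem rule168_density (n : ℕ) :
    (∀ p q : ℝ,
      ∑ b ∈ Finset.univ.filter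
          (fun b : Fin (2*n+1) → Bool => (blockMap f168)^[n] (List.ofFn b) = [true]),
        p ^ (List.ofFn b).count true * q ^ (List.ofFn b).count false
      = p ^ (n+1) * (p + 2*q) ^ n) ∧
    (∀ c₀ : ℝ,
      ∑ b ∈ Finset.univ.filter
          (fun b : Fin (2*n+1) → Bool => (blockMap f168)^[n] (List.ofFn b) = [true]),
        c₀ ^ (List.ofFn b).count true * (1 - c₀) ^ (List.ofFn b).count false
      = c₀ ^ (n+1) * (2 - c₀) ^ n) ∧
    (∑ b ∈ Finset.univ.filter
          (fun b : Fin (2*n+1) → Bool => (blockMap f168)^[n] (List.ofFn b) = [true]),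
        ((1:ℝ)/2) ^ (List.ofFn b).count true * ((1:ℝ)/2) ^ (List.ofFn b).count false
      = (3:ℝ) ^ n / 2 ^ (2*n+1)) := by
  refine ⟨sum_preimages_f168 n, fun c₀ => ?_, ?_⟩
  · rw [sum_preimages_f168]
    ring
  · rw [sum_preimages_f168, show (1 : ℝ) / 2 + 2 * (1 / 2) = 3 / 2 by norm_num, div_pow, div_pow,
      one_pow, div_mul_div_comm, one_mul, ← pow_add]
    congr 2
    ring
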